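/- Let r ≥ 2 and let N be a normal subgroup of F_r such that Γ_1(N) = F_r/N has polynomial volume growth of degree D ≥ 1. Let ℓ ≥ 3 and let μ_ℓ be the lazy simple random walk measure on Γ_ℓ(N) = F_r/N^{(ℓ)}. Then there exists C < ∞ such that for all sufficiently large n: μ_ℓ^{(2n)}(e) ≥ exp(−C·n·(log_{[ℓ−1]} n / log_{[ℓ−2]} n)^{2/D}). -/

import Mathlib

open scoped Pointwise

noncomputable section

open Classical in
/-- Convolution of two real-valued functions ("measures") on a group:
`(μ ∗ ν)(g) = Σ_h μ(h) ν(h⁻¹ g)`. -/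
noncomputable def conv {G : Type*} [Group G] (μ ν : G → ℝ) : G → ℝ :=
  fun g => ∑' h : G, μ h * ν (h⁻¹ * g)

open Classical in
/-- `convPow μ n` is the `n`-fold convolution power of `μ`;
`convPow μ 0` is the Dirac mass at the identity. -/
noncomputable def convPow {G : Type*} [Group G] (μ : G → ℝ) : ℕ → G → ℝ
  | 0 => fun g => if g = 1 then 1 else 0
  | n + 1 => conv μ (convPow μ n)

/-- Pushforward of a measure along a map. -/
noncomputable def pushforward {G H : Type*} (f : G → H) (μ : G → ℝ) : H → ℝ :=
  fun h => ∑' g : {g : G // f g = h}, μ g.1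

open Classical in
/-- The lazy simple random walk measure on the free group on `r` generators:
mass `1/2` at the identity and mass `1/(4r)` at each `sᵢ^{±1}`. -/
noncomputable def lazySRW (r : ℕ) : FreeGroup (Fin r) → ℝ := fun g =>
  if g = 1 then 1 / 2
  else if ∃ i : Fin r, g = FreeGroup.of i ∨ g = (FreeGroup.of i)⁻¹ then 1 / (4 * r)
  else 0

/-- The lazy simple random walk measure on the quotient `F_r / M`, i.e. the pushforward
of `lazySRW r` under the quotient map. -/
noncomputable def lazySRWQuot (r : ℕ) (M : Subgroup (FreeGroup (Fin r))) [M.Normal] :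
    FreeGroup (Fin r) ⧸ M → ℝ :=
  pushforward (QuotientGroup.mk : FreeGroup (Fin r) → FreeGroup (Fin r) ⧸ M) (lazySRW r)

/-- Iterated logarithms: `iterLog 1 x = log (1 + x)` and
`iterLog (i+1) x = log (1 + iterLog i x)`. -/
noncomputable def iterLog : ℕ → ℝ → ℝ
  | 0, x => x
  | n + 1, x => Real.log (1 + iterLog n x)

instance derivedSeriesNormal (G : Type*) [Group G] (n : ℕ) : (derivedSeries G n).Normal :=
  derivedSeries_normal G n

/-- `G` has polynomial volume growth of degree `D`: there is a finite symmetric generating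
set `S` containing the identity and constants `0 < c ≤ C` with
`c·n^D ≤ #(Sⁿ) ≤ C·n^D` for all `n ≥ 1`. -/
def HasPolyGrowth (G : Type*) [Group G] (D : ℕ) : Prop :=
  ∃ S : Set G, S.Finite ∧ (1 : G) ∈ S ∧ (∀ x ∈ S, x⁻¹ ∈ S) ∧ Subgroup.closure S = ⊤ ∧
    ∃ c C : ℝ, 0 < c ∧ c ≤ C ∧ ∀ n : ℕ, 1 ≤ n →
      c * (n : ℝ) ^ D ≤ (Nat.card ↥(S ^ n) : ℝ) ∧ (Nat.card ↥(S ^ n) : ℝ) ≤ C * (n : ℝ) ^ D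

/-- `G` has exponential volume growth: there is a finite symmetric generating set `S`
containing the identity and `c > 0` with `#(Sⁿ) ≥ e^{cn}` for all `n ≥ 1`. -/
def HasExpGrowth (G : Type*) [Group G] : Prop :=
  ∃ S : Set G, S.Finite ∧ (1 : G) ∈ S ∧ (∀ x ∈ S, x⁻¹ ∈ S) ∧ Subgroup.closure S = ⊤ ∧
    ∃ c : ℝ, 0 < c ∧ ∀ n : ℕ, 1 ≤ n → Real.exp (c * n) ≤ (Nat.card ↥(S ^ n) : ℝ)

/-- Iterated commutator subgroups: `iterComm N 0 = N` is `N^{(1)}` and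
`iterComm N j` is `N^{(j+1)} = [N^{(j)}, N^{(j)}]`. -/
def iterComm {G : Type*} [Group G] (N : Subgroup G) : ℕ → Subgroup G
  | 0 => N
  | j + 1 => ⁅iterComm N j, iterComm N j⁆

instance iterComm_normal {G : Type*} [Group G] (N : Subgroup G) [hN : N.Normal] (j : ℕ) :
    (iterComm N j).Normal := by
  induction j with
  | zero => exact hN
  | succ j ih => exact @Subgroup.commutator_normal G _ (iterComm N j) (iterComm N j) ih ih

/-- Abstract spectral lower bound. -/
theorem spectral_aux {E : Type*} [AddCommGroup E] [Module ℝ E] (B : LinearMap.BilinForm ℝ E)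
    (hB : ∀ x, 0 ≤ B x x) (hs : ∀ x y, B x y = B y x) (L : E →ₗ[ℝ] E)
    (hL : ∀ x y, B (L x) y = B x (L y)) (f : E) (ρ : ℝ) (hρ : 0 ≤ ρ) (hf : 0 < B f f)
    (h : ρ * B f f ≤ B f (L f)) (n : ℕ) :
    ρ ^ (2 * n) * B f f ≤ B ((L ^ n) f) ((L ^ n) f) := by
  rcases hρ.eq_or_lt with h0 | h0
  · subst h0
    rcases Nat.eq_zero_or_pos n with rfl | hn
    · simp
    · rw [zero_pow (by omega), zero_mul]; exact hB _
  have cs := fun x y => LinearMap.BilinForm.apply_mul_apply_le_of_forall_zero_le B hB x y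
  have key : ∀ k, 0 < B ((L ^ k) f) ((L ^ k) f) ∧
      ρ ^ 2 * B ((L ^ k) f) ((L ^ k) f) ≤ B ((L ^ (k+1)) f) ((L ^ (k+1)) f) := by
    intro k
    induction k with
    | zero =>
      refine ⟨by simpa using hf, ?_⟩
      have h1 := cs f (L f)
      rw [hs (L f) f] at h1
      have h2 : (ρ * B f f) * (ρ * B f f) ≤ B f (L f) * B f (L f) :=
        mul_self_le_mul_self (by positivity) h
      have : B f f * (ρ ^ 2 * B f f) ≤ B f f * B (L f) (L f) := by nlinarith
      simpa using le_of_mul_le_mul_left this hf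
    | succ k ih =>
      obtain ⟨ih1, ih2⟩ := ih
      have hp : 0 < B ((L ^ (k+1)) f) ((L ^ (k+1)) f) := lt_of_lt_of_le (by positivity) ih2
      refine ⟨hp, ?_⟩
      have h1 := cs ((L ^ k) f) ((L ^ (k+2)) f)
      have e : B ((L ^ k) f) ((L ^ (k+2)) f) = B ((L ^ (k+1)) f) ((L ^ (k+1)) f) := by
        rw [show k + 2 = (k+1) + 1 from rfl, pow_succ' L (k+1), Module.End.mul_apply, ← hL,
          ← Module.End.mul_apply, ← pow_succ']
      rw [hs ((L ^ (k+2)) f), e] at h1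
      rw [show k + 1 + 1 = k + 2 from rfl]
      set a := B ((L ^ k) f) ((L ^ k) f)
      set b := B ((L ^ (k+1)) f) ((L ^ (k+1)) f)
      set c := B ((L ^ (k+2)) f) ((L ^ (k+2)) f)
      have : a * (ρ ^ 2 * b) ≤ a * c := by nlinarith
      exact le_of_mul_le_mul_left this ih1
  induction n with
  | zero => simp
  | succ n ih =>
    have := (key n).2
    calc ρ ^ (2 * (n+1)) * B f f = ρ ^ 2 * (ρ ^ (2 * n) * B f f) := by ring
      _ ≤ ρ ^ 2 * B ((L ^ n) f) ((L ^ n) f) := by gcongr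
      _ ≤ _ := this

/-- Left convolution operator on functions. -/
def Lop {F G : Type*} [Group F] [Group G] (W : Finset F) (w : F → ℝ) (q : F →* G)
    (f : G → ℝ) : G → ℝ := fun x => ∑ g ∈ W, w g * f (q g * x)

/-- Existence of a good test function. -/
def Good {F G : Type*} [Group F] [Group G] (W : Finset F) (w : F → ℝ) (q : F →* G)
    (ρ V : ℝ) : Prop :=
  ∃ (U : Finset G) (f : G → ℝ), (∀ x, 0 ≤ f x) ∧ (∀ x, x ∉ U → f x = 0) ∧
    0 < ∑ x ∈ U, f x ^ 2 ∧ (U.card : ℝ) ≤ V ∧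
    ρ * ∑ x ∈ U, f x ^ 2 ≤ ∑ x ∈ U, f x * Lop W w q f x

/-- The finitely supported version. -/
def Lfs {F G : Type*} [Group F] [Group G] (W : Finset F) (w : F → ℝ) (q : F →* G) :
    (G →₀ ℝ) →ₗ[ℝ] (G →₀ ℝ) :=
  ∑ g ∈ W, w g • (Finsupp.domLCongr (R := ℝ) (M := ℝ) (Equiv.mulLeft (q g)⁻¹)).toLinearMap

theorem Lfs_apply {F G : Type*} [Group F] [Group G] (W : Finset F) (w : F → ℝ) (q : F →* G)
    (f : G →₀ ℝ) : ⇑(Lfs W w q f) = Lop W w q ⇑f := by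
  ext x
  simp [Lfs, Lop, Finsupp.finsetSum_apply, LinearMap.sum_apply]

theorem Lfs_pow_apply {F G : Type*} [Group F] [Group G] (W : Finset F) (w : F → ℝ) (q : F →* G)
    (n : ℕ) (f : G →₀ ℝ) : ⇑((Lfs W w q ^ n) f) = (Lop W w q)^[n] ⇑f := by
  induction n with
  | zero => simp
  | succ n ih =>
    rw [pow_succ', Module.End.mul_apply, Lfs_apply, ih, Function.iterate_succ_apply']

/-- The bilinear form. -/
def Bfs (G : Type*) : LinearMap.BilinForm ℝ (G →₀ ℝ) :=
  LinearMap.mk₂ ℝ (fun f g => f.sum fun x a => a * g x)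
    (fun f f' g => by
      rw [Finsupp.sum_add_index'] <;> intros <;> ring)
    (fun c f g => by
      rw [Finsupp.sum_smul_index' (by intros; ring), Finsupp.smul_sum]
      simp [mul_assoc])
    (fun f g g' => by simp [mul_add, Finsupp.sum_add])
    (fun c f g => by
      simp only [Finsupp.smul_apply, smul_eq_mul, Finsupp.mul_sum]
      congr 1; ext; intros; ring)

theorem Bfs_eq {G : Type*} (f g : G →₀ ℝ) (U : Finset G) (hU : ∀ x, x ∉ U → f x = 0) :
    Bfs G f g = ∑ x ∈ U, f x * g x := by
  change (f.sum fun x a => a * g x) = _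
  rw [Finsupp.sum]
  apply Finset.sum_subset
  · intro x hx
    by_contra h
    exact (Finsupp.mem_support_iff.1 hx) (hU x h)
  · intro x _ h
    rw [Finsupp.notMem_support_iff.1 h, zero_mul]

theorem Bfs_eq' {G : Type*} (f g : G →₀ ℝ) : Bfs G f g = ∑ x ∈ f.support, f x * g x := rfl

theorem Bfs_single {G : Type*} (x : G) (g : G →₀ ℝ) : Bfs G (Finsupp.single x 1) g = g x := by
  classical
  rw [Bfs_eq _ _ {x}]
  · simp
  · intro y hy
    simp at hy
    simp [Finsupp.single_apply, Ne.symm hy]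

theorem Bfs_nonneg {G : Type*} (f : G →₀ ℝ) : 0 ≤ Bfs G f f := by
  rw [Bfs_eq']; exact Finset.sum_nonneg fun x _ => mul_self_nonneg _

theorem Bfs_symm {G : Type*} (f g : G →₀ ℝ) : Bfs G f g = Bfs G g f := by
  classical
  rw [Bfs_eq f g (f.support ∪ g.support), Bfs_eq g f (f.support ∪ g.support)]
  · simp_rw [mul_comm]
  all_goals
    intro x hx
    simp at hx
    tauto

theorem Bfs_L {F G : Type*} [Group F] [Group G] (W : Finset F) (w : F → ℝ) (q : F →* G)
    (hW : ∀ g ∈ W, g⁻¹ ∈ W) (hw : ∀ g, w g⁻¹ = w g) (f g : G →₀ ℝ) :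
    Bfs G (Lfs W w q f) g = Bfs G f (Lfs W w q g) := by
  classical
  induction f using Finsupp.induction_linear with
  | zero => simp
  | add f f' h h' => simp [h, h']
  | single x c =>
    induction g using Finsupp.induction_linear with
    | zero => simp
    | add f f' h h' => simp [h, h']
    | single y d =>
      have e1 : ∀ (z : G) (c : ℝ), Finsupp.single z c = c • Finsupp.single z 1 := by simp
      rw [e1 x, e1 y]
      simp only [map_smul, LinearMap.smul_apply]
      congr 2
      rw [Bfs_symm, Bfs_single, Bfs_single, Lfs_apply, Lfs_apply]
      unfold Lop
      refine Finset.sum_nbij' (·⁻¹) (·⁻¹) hW hW (by simp) (by simp) ?_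
      intro g _
      rw [hw, map_inv]
      congr 1
      simp only [Finsupp.single_apply]
      congr 1
      rw [eq_iff_iff]
      constructor
      · rintro rfl; group
      · rintro rfl; group

theorem Lop_transl {F G : Type*} [Group F] [Group G] (W : Finset F) (w : F → ℝ) (q : F →* G)
    (x : G) (n : ℕ) (y : G) :
    ((Lop W w q)^[n] ⇑(Finsupp.single x (1:ℝ))) (y * x) =
      ((Lop W w q)^[n] ⇑(Finsupp.single (1:G) (1:ℝ))) y := by
  classical
  induction n generalizing y with
  | zero => simp [Finsupp.single_apply, eq_comm]
  | succ n ih =>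
    rw [Function.iterate_succ_apply', Function.iterate_succ_apply']
    unfold Lop at ih ⊢
    refine Finset.sum_congr rfl fun g _ => ?_
    rw [← mul_assoc, ih]

theorem return_of_good {F G : Type*} [Group F] [Group G] (W : Finset F) (w : F → ℝ) (q : F →* G)
    (hW : ∀ g ∈ W, g⁻¹ ∈ W) (hw : ∀ g, w g⁻¹ = w g) (ρ V : ℝ) (hρ : 0 ≤ ρ)
    (h : Good W w q ρ V) (n : ℕ) :
    ρ ^ (2 * n) ≤ V * ((Lop W w q)^[2 * n] ⇑(Finsupp.single (1:G) (1:ℝ))) 1 := by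
  classical
  obtain ⟨U, f, hf0, hfU, hpos, hcard, hray⟩ := h
  set p := ((Lop W w q)^[2 * n] ⇑(Finsupp.single (1:G) (1:ℝ))) 1 with hp
  set L := Lfs W w q with hLdef
  let φ : G →₀ ℝ := Finsupp.onFinset U f (fun x hx => by
    by_contra h; exact hx (hfU x h))
  have hφ : ⇑φ = f := rfl
  have hBφ : Bfs G φ φ = ∑ x ∈ U, f x ^ 2 := by
    rw [Bfs_eq φ φ U hfU]; simp [hφ, sq]
  have hBL : Bfs G φ (L φ) = ∑ x ∈ U, f x * Lop W w q f x := by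
    rw [Bfs_eq φ _ U hfU, hLdef, Lfs_apply, hφ]
  have hsym : ∀ x y, Bfs G (L x) y = Bfs G x (L y) := Bfs_L W w q hW hw
  have h1 := spectral_aux (Bfs G) Bfs_nonneg Bfs_symm L hsym φ ρ hρ (by rw [hBφ]; exact hpos)
    (by rw [hBφ, hBL]; exact hray) n
  have hsymn : ∀ k x y, Bfs G ((L ^ k) x) y = Bfs G x ((L ^ k) y) := by
    intro k
    induction k with
    | zero => simp
    | succ k ih =>
      intro x y
      rw [pow_succ, Module.End.mul_apply, ih, hsym, ← Module.End.mul_apply, ← pow_succ', pow_succ]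
  have hd : ∀ x : G, Bfs G ((L ^ n) (Finsupp.single x 1)) ((L ^ n) (Finsupp.single x 1)) = p := by
    intro x
    rw [hsymn, Bfs_single, ← Module.End.mul_apply, ← pow_add, ← two_mul, hLdef, Lfs_pow_apply]
    have := Lop_transl W w q x (2 * n) 1
    rwa [one_mul] at this
  have hxy : ∀ x y : G,
      Bfs G ((L ^ n) (Finsupp.single x 1)) ((L ^ n) (Finsupp.single y 1)) ≤ p := by
    intro x y
    have := Bfs_nonneg ((L ^ n) (Finsupp.single x 1) - (L ^ n) (Finsupp.single y 1))
    simp only [map_sub, LinearMap.sub_apply] at this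
    rw [hd, hd, Bfs_symm ((L ^ n) (Finsupp.single y 1))] at this
    linarith
  have hsum : φ = ∑ x ∈ U, f x • Finsupp.single x (1:ℝ) := by
    ext y
    simp only [Finsupp.finsetSum_apply, Finsupp.smul_apply, Finsupp.single_apply, smul_eq_mul,
      mul_ite, mul_one, mul_zero, Finset.sum_ite_eq', hφ]
    split_ifs with h
    · rfl
    · exact hfU y h
  have h2 : Bfs G ((L ^ n) φ) ((L ^ n) φ) ≤ (∑ x ∈ U, f x) ^ 2 * p := by
    conv_lhs => rw [hsum]
    simp only [map_sum, map_smul, LinearMap.sum_apply, LinearMap.smul_apply, smul_eq_mul]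
    rw [sq, Finset.sum_mul_sum, Finset.sum_mul]
    refine Finset.sum_le_sum fun x _ => ?_
    rw [Finset.mul_sum, Finset.sum_mul]
    refine Finset.sum_le_sum fun y _ => ?_
    have h3 := mul_nonneg (hf0 x) (hf0 y)
    calc _ = f x * f y *
        Bfs G ((L ^ n) (Finsupp.single x 1)) ((L ^ n) (Finsupp.single y 1)) := by
          rw [Bfs_symm]; ring
      _ ≤ _ := mul_le_mul_of_nonneg_left (hxy x y) h3
  have h3 : (∑ x ∈ U, f x) ^ 2 ≤ U.card * ∑ x ∈ U, f x ^ 2 := sq_sum_le_card_mul_sum_sq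
  have hp0 : 0 ≤ p := by rw [← hd 1]; exact Bfs_nonneg _
  rw [hBφ] at h1
  have h4 : ρ ^ (2 * n) * ∑ x ∈ U, f x ^ 2 ≤ (V * p) * ∑ x ∈ U, f x ^ 2 := by
    calc _ ≤ _ := h1
      _ ≤ _ := h2
      _ ≤ (U.card * ∑ x ∈ U, f x ^ 2) * p := by gcongr
      _ ≤ (V * ∑ x ∈ U, f x ^ 2) * p := by gcongr
      _ = _ := by ring
  exact le_of_mul_le_mul_right h4 hpos

/-- Almost invariant functions in an abelian group. -/
theorem folner_abelian {A ι : Type*} [CommGroup A] [Fintype ι] (t : ι → A) (q : ℕ) (hq : 1 ≤ q) :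
    ∃ (B : Finset A) (φ : A → ℝ), (∀ a, 0 ≤ φ a) ∧ (∀ a, a ∉ B → φ a = 0) ∧
      0 < ∑ a ∈ B, φ a ^ 2 ∧ B.card ≤ q ^ Fintype.card ι ∧
      ∀ i, (1 - 1 / (q:ℝ)) * ∑ a ∈ B, φ a ^ 2 ≤ ∑ a ∈ B, φ a * φ (t i * a) := by
  classical
  let box : Finset (ι → ℕ) := Fintype.piFinset fun _ => Finset.range q
  have hbox : box.card = q ^ Fintype.card ι := by simp [box, Fintype.card_piFinset]
  let p : (ι → ℕ) → A := fun c => ∏ i, t i ^ c i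
  let N : A → ℕ := fun a => (box.filter fun c => p c = a).card
  let B := box.image p
  have hS : ∑ a ∈ B, N a = q ^ Fintype.card ι := by
    rw [← hbox]
    exact (Finset.card_eq_sum_card_fiberwise (fun c hc => Finset.mem_image_of_mem p hc)).symm
  have hS' : ∑ a ∈ B, Real.sqrt (N a) ^ 2 = (q:ℝ) ^ Fintype.card ι := by
    simp only [Real.sq_sqrt (Nat.cast_nonneg _)]
    exact_mod_cast hS
  refine ⟨B, fun a => Real.sqrt (N a), fun a => Real.sqrt_nonneg _, ?_, ?_, ?_, ?_⟩
  · intro a ha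
    have : N a = 0 := by
      simp only [N, Finset.card_eq_zero, Finset.filter_eq_empty_iff]
      intro c hc h
      exact ha (h ▸ Finset.mem_image_of_mem p hc)
    simp [this]
  · rw [hS']; positivity
  · rw [← hbox]; exact Finset.card_image_le
  · intro i
    rw [hS']
    let box' : Finset (ι → ℕ) :=
      Fintype.piFinset (Function.update (fun _ => Finset.range q) i (Finset.range (q - 1)))
    have hsub : ∀ c ∈ box', c ∈ box ∧ c i < q - 1 := by
      intro c hc
      simp only [box', box, Fintype.mem_piFinset] at hc ⊢
      have hi := hc i
      simp at hi
      refine ⟨fun j => ?_, hi⟩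
      by_cases hj : j = i
      · subst hj; simp; omega
      · have := hc j
        simpa [Function.update_of_ne hj] using this
    have hcard' : q * box'.card = (q - 1) * q ^ Fintype.card ι := by
      simp only [box', Fintype.card_piFinset]
      have : ∀ j, (Function.update (fun _ : ι => Finset.range q) i (Finset.range (q - 1)) j).card
          = Function.update (fun _ : ι => q) i (q - 1) j := by
        intro j
        by_cases hj : j = i
        · subst hj; simp
        · simp [Function.update_of_ne hj]
      simp only [this]
      rw [Finset.prod_update_of_mem (Finset.mem_univ i)]
      have h2 : q ^ Fintype.card ι = q * ∏ x ∈ Finset.univ \ {i}, q := by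
        rw [← Finset.prod_update_of_mem (Finset.mem_univ i) (fun _ => q) q]
        simp
      rw [h2]; ring
    have hmin : ∀ a, (box'.filter fun c => p c = a).card ≤ min (N a) (N (t i * a)) := by
      intro a
      refine le_min ?_ ?_
      · apply Finset.card_le_card
        intro c hc
        simp only [Finset.mem_filter] at hc ⊢
        exact ⟨(hsub c hc.1).1, hc.2⟩
      · apply Finset.card_le_card_of_injOn (fun c => c + Pi.single i 1)
        · intro c hc
          simp only [Finset.coe_filter, Set.mem_ofPred_eq] at hc ⊢
          obtain ⟨hb, hlt⟩ := hsub c hc.1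
          constructor
          · simp only [box, Fintype.mem_piFinset, Finset.mem_range] at hb ⊢
            intro j
            by_cases hj : j = i
            · subst hj; simp; omega
            · simp [Pi.single_eq_of_ne hj]; exact hb j
          · rw [← hc.2]
            simp only [p, Pi.add_apply, pow_add, Finset.prod_mul_distrib]
            rw [mul_comm]
            congr 1
            rw [Finset.prod_eq_single i]
            · simp
            · intro j _ hj; simp [Pi.single_eq_of_ne hj]
            · simp
        · intro c _ c' _ h
          exact add_right_cancel h
    have hle : (box'.card : ℝ) ≤ ∑ a ∈ B, Real.sqrt (N a) * Real.sqrt (N (t i * a)) := by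
      rw [Finset.card_eq_sum_card_fiberwise (f := p) (s := box') (t := B)
        (fun c hc => Finset.mem_image_of_mem p (hsub c hc).1)]
      push_cast
      refine Finset.sum_le_sum fun a _ => ?_
      have h1 := hmin a
      have h2 : ((box'.filter fun c => p c = a).card : ℝ) ≤ N a := by
        exact_mod_cast h1.trans (min_le_left _ _)
      have h3 : ((box'.filter fun c => p c = a).card : ℝ) ≤ N (t i * a) := by
        exact_mod_cast h1.trans (min_le_right _ _)
      rw [← Real.sqrt_mul (Nat.cast_nonneg _)]
      apply Real.le_sqrt_of_sq_le
      rw [sq]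
      exact mul_le_mul h2 h3 (Nat.cast_nonneg _) (Nat.cast_nonneg _)
    refine le_trans (le_of_eq ?_) hle
    have hq0 : (0:ℝ) < q := by exact_mod_cast hq
    have : (q:ℝ) * box'.card = (q - 1) * q ^ Fintype.card ι := by
      have := congrArg (Nat.cast : ℕ → ℝ) hcard'
      push_cast [Nat.cast_sub hq] at this
      exact this
    field_simp
    linarith

/-- Lifting test functions through an extension with abelian kernel. -/
theorem good_lift {F G G' : Type*} [Group F] [Group G] [Group G'] (W : Finset F) (w : F → ℝ)
    (hw0 : ∀ g, 0 ≤ w g)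
    (k : F →* G) (k' : F →* G') (π : G' →* G) (hπ : Function.Surjective π)
    (hk : ∀ g, π (k' g) = k g)
    (hcomm : ∀ a b, π a = 1 → π b = 1 → a * b = b * a) (q : ℕ) (hq : 1 ≤ q) (ρ V : ℝ)
    (h : Good W w k ρ V) :
    Good W w k' ((1 - 1 / (q:ℝ)) * ρ) (V * (q:ℝ) ^ (W.card * V)) := by
  classical
  obtain ⟨U, f, hf0, hfU, hpos, hcard, hray⟩ := h
  obtain ⟨σ, hσ⟩ := hπ.hasRightInverse
  letI : CommGroup π.ker :=
    { (inferInstance : Group π.ker) with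
      mul_comm := fun a b => Subtype.ext (hcomm a b a.2 b.2) }
  let t : W × U → π.ker := fun i =>
    ⟨(σ (k i.1 * i.2))⁻¹ * k' i.1 * σ i.2, by
      simp [MonoidHom.mem_ker, hσ _, hk]⟩
  obtain ⟨B, φ, hφ0, hφB, hφpos, hBcard, hinv⟩ := folner_abelian t q hq
  let a : G' → π.ker := fun x => ⟨(σ (π x))⁻¹ * x, by simp [MonoidHom.mem_ker, hσ _]⟩
  let j : G × π.ker → G' := fun u => σ u.1 * u.2
  have hπj : ∀ u b, π (j (u, b)) = u := by
    intro u b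
    simp only [j, map_mul, hσ u]
    rw [b.2, mul_one]
  have haj : ∀ u b, a (j (u, b)) = b := by
    intro u b
    apply Subtype.ext
    change (σ (π (j (u, b))))⁻¹ * j (u, b) = b
    rw [hπj]; simp [j]
  have hja : ∀ x, j (π x, a x) = x := by
    intro x; simp [j, a]
  have hjinj : Function.Injective j := by
    rintro ⟨u, b⟩ ⟨u', b'⟩ h
    have h1 := congrArg π h
    have h2 := congrArg a h
    rw [hπj, hπj] at h1
    rw [haj, haj] at h2
    rw [h1, h2]
  let Φ : G' → ℝ := fun x => f (π x) * φ (a x)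
  have hsumj : ∀ H : G' → ℝ, ∑ x ∈ (U ×ˢ B).image j, H x = ∑ u ∈ U, ∑ b ∈ B, H (j (u, b)) := by
    intro H
    rw [Finset.sum_image (fun x _ y _ h => hjinj h), Finset.sum_product]
  have hsq : ∑ x ∈ (U ×ˢ B).image j, Φ x ^ 2 = (∑ u ∈ U, f u ^ 2) * ∑ b ∈ B, φ b ^ 2 := by
    rw [hsumj, Finset.sum_mul_sum]
    refine Finset.sum_congr rfl fun u _ => Finset.sum_congr rfl fun b _ => ?_
    simp only [Φ, hπj, haj]; ring
  have hq0 : (1:ℝ) ≤ q := by exact_mod_cast hq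
  refine ⟨(U ×ˢ B).image j, Φ, fun x => mul_nonneg (hf0 _) (hφ0 _), ?_, ?_, ?_, ?_⟩
  · intro x hx
    by_cases h1 : π x ∈ U
    · by_cases h2 : a x ∈ B
      · exact absurd (Finset.mem_image.2 ⟨(π x, a x), Finset.mk_mem_product h1 h2, hja x⟩) hx
      · simp [Φ, hφB _ h2]
    · simp [Φ, hfU _ h1]
  · rw [hsq]; positivity
  · rw [Finset.card_image_of_injective _ hjinj, Finset.card_product]
    push_cast
    have h0 : (0:ℝ) ≤ U.card := Nat.cast_nonneg _
    have h1 : (B.card : ℝ) ≤ (q:ℝ) ^ (W.card * V) := by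
      calc (B.card : ℝ) ≤ (q:ℝ) ^ (W.card * U.card) := by
            have := hBcard
            simp only [Fintype.card_prod, Fintype.card_coe] at this
            exact_mod_cast this
        _ = (q:ℝ) ^ ((W.card : ℝ) * (U.card : ℝ)) := by
            rw [← Real.rpow_natCast]; push_cast; rfl
        _ ≤ _ := by
            apply Real.rpow_le_rpow_of_exponent_le hq0
            gcongr
    exact mul_le_mul hcard h1 (Nat.cast_nonneg _) (h0.trans hcard)
  · rw [hsq, hsumj]
    have hstep : ∀ g ∈ W, ∀ u ∈ U,
        (1 - 1 / (q:ℝ)) * (∑ b ∈ B, φ b ^ 2) * (f u * f (k g * u)) ≤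
          ∑ b ∈ B, Φ (j (u, b)) * Φ (k' g * j (u, b)) := by
      intro g hg u hu
      have h1 := hinv (⟨g, hg⟩, ⟨u, hu⟩)
      calc _ ≤ (∑ b ∈ B, φ b * φ (t (⟨g, hg⟩, ⟨u, hu⟩) * b)) * (f u * f (k g * u)) :=
            mul_le_mul_of_nonneg_right h1 (mul_nonneg (hf0 _) (hf0 _))
        _ = _ := by
          rw [Finset.sum_mul]
          refine Finset.sum_congr rfl fun b _ => ?_
          have e1 : π (k' g * j (u, b)) = k g * u := by rw [map_mul, hk, hπj]
          have e2 : a (k' g * j (u, b)) = t (⟨g, hg⟩, ⟨u, hu⟩) * b := by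
            apply Subtype.ext
            change (σ (π (k' g * j (u, b))))⁻¹ * (k' g * j (u, b)) =
              (σ (k g * u))⁻¹ * k' g * σ u * b
            rw [e1]; simp only [j, mul_assoc]
          simp only [Φ, e1, e2, hπj, haj]; ring
    calc (1 - 1 / (q:ℝ)) * ρ * ((∑ u ∈ U, f u ^ 2) * ∑ b ∈ B, φ b ^ 2)
        = ((1 - 1 / (q:ℝ)) * ∑ b ∈ B, φ b ^ 2) * (ρ * ∑ u ∈ U, f u ^ 2) := by ring
      _ ≤ ((1 - 1 / (q:ℝ)) * ∑ b ∈ B, φ b ^ 2) * ∑ x ∈ U, f x * Lop W w k f x := by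
        apply mul_le_mul_of_nonneg_left hray
        apply mul_nonneg _ hφpos.le
        rw [sub_nonneg, div_le_one (by linarith)]; exact hq0
      _ = ∑ u ∈ U, ∑ g ∈ W,
          w g * ((1 - 1 / (q:ℝ)) * (∑ b ∈ B, φ b ^ 2) * (f u * f (k g * u))) := by
        generalize (1 - 1 / (q:ℝ)) * ∑ b ∈ B, φ b ^ 2 = c0
        rw [Finset.mul_sum]
        refine Finset.sum_congr rfl fun u _ => ?_
        unfold Lop
        rw [Finset.mul_sum, Finset.mul_sum]
        refine Finset.sum_congr rfl fun g _ => ?_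
        ring
      _ ≤ ∑ u ∈ U, ∑ g ∈ W, w g * ∑ b ∈ B, Φ (j (u, b)) * Φ (k' g * j (u, b)) := by
        refine Finset.sum_le_sum fun u hu => Finset.sum_le_sum fun g hg => ?_
        exact mul_le_mul_of_nonneg_left (hstep g hg u hu) (hw0 g)
      _ = ∑ u ∈ U, ∑ b ∈ B, Φ (j (u, b)) * Lop W w k' Φ (j (u, b)) := by
        refine Finset.sum_congr rfl fun u _ => ?_
        simp only [Finset.mul_sum]
        rw [Finset.sum_comm]
        refine Finset.sum_congr rfl fun b _ => ?_
        unfold Lop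
        rw [Finset.mul_sum]
        refine Finset.sum_congr rfl fun g _ => ?_
        ring

theorem good_base {F G : Type*} [Group F] [Group G] (W : Finset F) (w : F → ℝ) (q : F →* G)
    (hw0 : ∀ g, 0 ≤ w g) (hw1 : ∑ g ∈ W, w g = 1) (D : ℕ) (hG : HasPolyGrowth G D) :
    ∃ c1 C1 : ℝ, 0 ≤ c1 ∧ 0 < C1 ∧ ∀ R : ℕ, 2 ≤ R →
      Good W w q (1 - c1 / (R:ℝ) ^ 2) (C1 * (R:ℝ) ^ D) := by
  classical
  obtain ⟨S, hfin, h1S, hinv, hgen, c, C, hc, hcC, hgr⟩ := hG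
  have hC : 0 < C := hc.trans_le hcC
  have hex : ∀ x : G, ∃ n, x ∈ S ^ n := by
    intro x
    have hx : x ∈ Subgroup.closure S := by rw [hgen]; trivial
    induction hx using Subgroup.closure_induction with
    | mem x hx => exact ⟨1, by simpa using hx⟩
    | one => exact ⟨0, by simp⟩
    | mul x y _ _ ihx ihy =>
      obtain ⟨m, hm⟩ := ihx
      obtain ⟨n, hn⟩ := ihy
      exact ⟨m + n, by rw [pow_add]; exact Set.mul_mem_mul hm hn⟩
    | inv x _ ih =>
      obtain ⟨m, hm⟩ := ih
      have hS : S⁻¹ = S := by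
        ext y
        rw [Set.mem_inv]
        exact ⟨fun h => by simpa using hinv _ h, fun h => hinv _ h⟩
      refine ⟨m, ?_⟩
      rw [← Set.mem_inv, ← inv_pow, hS]
      exact hm
  let nm : G → ℕ := fun x => Nat.find (hex x)
  have hnm : ∀ x n, nm x ≤ n ↔ x ∈ S ^ n := by
    intro x n
    constructor
    · intro h
      exact Set.pow_subset_pow_right h1S h (Nat.find_spec (hex x))
    · intro h
      exact Nat.find_min' (hex x) h
  have hmul : ∀ x y, nm (x * y) ≤ nm x + nm y := by
    intro x y
    rw [hnm, pow_add]
    exact Set.mul_mem_mul ((hnm _ _).1 le_rfl) ((hnm _ _).1 le_rfl)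
  obtain ⟨k, hk⟩ : ∃ k : ℕ, ∀ g ∈ W, nm (q g) ≤ k ∧ nm (q g)⁻¹ ≤ k := by
    refine ⟨∑ g ∈ W, (nm (q g) + nm (q g)⁻¹), fun g hg => ?_⟩
    have := Finset.single_le_sum (f := fun g => nm (q g) + nm (q g)⁻¹)
      (fun _ _ => Nat.zero_le _) hg
    have h2 : nm (q g) + nm (q g)⁻¹ ≤ ∑ g ∈ W, (nm (q g) + nm (q g)⁻¹) := this
    omega
  have hSfin : ∀ n, (S ^ n).Finite := by
    intro n
    induction n with
    | zero => simp
    | succ n ih => rw [pow_succ]; exact ih.mul hfin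
  let b : ℕ → Finset G := fun n => (hSfin n).toFinset
  have hb : ∀ n x, x ∈ b n ↔ nm x ≤ n := by
    intro n x
    rw [Set.Finite.mem_toFinset, hnm]
  have hbc : ∀ n, Nat.card ↥(S ^ n) = (b n).card := by
    intro n
    rw [Nat.card_coe_set_eq, Set.ncard_eq_toFinset_card _ (hSfin n)]
  refine ⟨(k:ℝ) ^ 2 / 2 * (C * (1 + k) ^ D) * 4 ^ (D + 1) / c, C * (1 + k) ^ D, by positivity,
    by positivity, ?_⟩
  intro R hR
  let f : G → ℝ := fun x => ((R - nm x : ℕ) : ℝ)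
  have hR0 : (0:ℝ) < R := by exact_mod_cast (by omega : 0 < R)
  have hUcard : ((b (R + k)).card : ℝ) ≤ C * (1 + k) ^ D * (R:ℝ) ^ D := by
    rw [← hbc]
    refine (hgr (R + k) (by omega)).2.trans ?_
    rw [mul_assoc, ← mul_pow]
    have : ((R + k : ℕ) : ℝ) ≤ (1 + k) * R := by
      push_cast
      have : (1:ℝ) ≤ R := by exact_mod_cast (by omega : 1 ≤ R)
      nlinarith [(Nat.cast_nonneg k : (0:ℝ) ≤ k)]
    gcongr
  have hf0 : ∀ x, x ∉ b R → f x = 0 := by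
    intro x hx
    rw [hb] at hx
    simp only [f]
    rw [Nat.sub_eq_zero_of_le (by omega)]; simp
  have hbsub : b R ⊆ b (R + k) := by
    intro x; rw [hb, hb]; omega
  have hsumR : ∑ x ∈ b (R + k), f x ^ 2 = ∑ x ∈ b R, f x ^ 2 := by
    symm
    apply Finset.sum_subset hbsub
    intro x _ hx
    rw [hf0 x hx]; simp
  have hlow : c * (R:ℝ) ^ D * (R:ℝ) ^ 2 / 4 ^ (D + 1) ≤ ∑ x ∈ b (R + k), f x ^ 2 := by
    have hT := (hgr (R / 2) (by omega)).1
    rw [hbc] at hT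
    have hT1 : (R:ℝ) / 4 ≤ ((R / 2 : ℕ) : ℝ) := by
      have : R ≤ 4 * (R / 2) := by omega
      have : (R:ℝ) ≤ 4 * ((R / 2 : ℕ) : ℝ) := by exact_mod_cast this
      linarith
    calc c * (R:ℝ) ^ D * (R:ℝ) ^ 2 / 4 ^ (D + 1) = c * (R / 4) ^ D * (R / 2) ^ 2 := by
          rw [div_pow, div_pow]; field_simp; norm_num; ring
      _ ≤ c * ((R / 2 : ℕ) : ℝ) ^ D * (R / 2) ^ 2 := by gcongr
      _ ≤ (b (R / 2)).card * ((R:ℝ) / 2) ^ 2 := by gcongr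
      _ = ∑ x ∈ b (R / 2), ((R:ℝ) / 2) ^ 2 := by simp
      _ ≤ ∑ x ∈ b (R / 2), f x ^ 2 := by
        refine Finset.sum_le_sum fun x hx => ?_
        rw [hb] at hx
        have h2 : R ≤ 2 * (R - nm x) := by omega
        have h3 : (R:ℝ) ≤ 2 * ((R - nm x : ℕ) : ℝ) := by exact_mod_cast h2
        have : (R:ℝ) / 2 ≤ f x := by simp only [f]; linarith
        gcongr
      _ ≤ _ := by
        apply Finset.sum_le_sum_of_subset_of_nonneg
        · intro x; rw [hb, hb]; omega
        · intros; positivity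
  refine ⟨b (R + k), f, fun x => Nat.cast_nonneg _, fun x hx => hf0 x fun h => hx (hbsub h), ?_,
    hUcard, ?_⟩
  · exact lt_of_lt_of_le (by positivity) hlow
  · have hstep : ∀ g ∈ W, ∑ x ∈ b (R + k), f x ^ 2 - (k:ℝ) ^ 2 / 2 * (b (R + k)).card ≤
        ∑ x ∈ b (R + k), f x * f (q g * x) := by
      intro g hg
      obtain ⟨hg1, hg2⟩ := hk g hg
      have hshift : ∑ x ∈ b (R + k), f x ^ 2 ≤ ∑ x ∈ b (R + k), f (q g * x) ^ 2 := by
        rw [hsumR, ← Finset.sum_image (s := b (R + k)) (g := fun x => q g * x)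
          (f := fun y => f y ^ 2) (fun x _ y _ h => mul_left_cancel h)]
        apply Finset.sum_le_sum_of_subset_of_nonneg
        · intro y hy
          rw [hb] at hy
          refine Finset.mem_image.2 ⟨(q g)⁻¹ * y, ?_, by simp⟩
          rw [hb]
          have := hmul (q g)⁻¹ y
          omega
        · intros; positivity
      have hdiff : ∀ x, (f x - f (q g * x)) ^ 2 ≤ (k:ℝ) ^ 2 := by
        intro x
        have h1 := hmul (q g) x
        have h2 := hmul (q g)⁻¹ (q g * x)
        rw [inv_mul_cancel_left] at h2
        rw [sq_le_sq, abs_of_nonneg (Nat.cast_nonneg k : (0:ℝ) ≤ k), abs_le]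
        simp only [f]
        constructor
        · have : R - nm (q g * x) ≤ (R - nm x) + k := by omega
          have : ((R - nm (q g * x) : ℕ) : ℝ) ≤ ((R - nm x : ℕ) : ℝ) + k := by exact_mod_cast this
          linarith
        · have : R - nm x ≤ (R - nm (q g * x)) + k := by omega
          have : ((R - nm x : ℕ) : ℝ) ≤ ((R - nm (q g * x) : ℕ) : ℝ) + k := by exact_mod_cast this
          linarith
      have hs : ∑ x ∈ b (R + k), (f x - f (q g * x)) ^ 2 ≤ (k:ℝ) ^ 2 * (b (R + k)).card := by
        calc _ ≤ ∑ x ∈ b (R + k), (k:ℝ) ^ 2 := Finset.sum_le_sum fun x _ => hdiff x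
          _ = _ := by simp; ring
      have he : ∑ x ∈ b (R + k), f x * f (q g * x) = (∑ x ∈ b (R + k), f x ^ 2 +
          ∑ x ∈ b (R + k), f (q g * x) ^ 2 - ∑ x ∈ b (R + k), (f x - f (q g * x)) ^ 2) / 2 := by
        rw [← Finset.sum_add_distrib, ← Finset.sum_sub_distrib, Finset.sum_div]
        refine Finset.sum_congr rfl fun x _ => ?_
        ring
      rw [he]
      linarith
    have hE : ∑ x ∈ b (R + k), f x * Lop W w q f x =
        ∑ g ∈ W, w g * ∑ x ∈ b (R + k), f x * f (q g * x) := by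
      simp only [Lop, Finset.mul_sum]
      rw [Finset.sum_comm]
      refine Finset.sum_congr rfl fun x _ => Finset.sum_congr rfl fun g _ => ?_
      ring
    rw [hE]
    calc _ ≤ ∑ x ∈ b (R + k), f x ^ 2 - (k:ℝ) ^ 2 / 2 * (b (R + k)).card := by
          rw [sub_mul, one_mul]
          apply sub_le_sub_left
          calc (k:ℝ) ^ 2 / 2 * (b (R + k)).card
              ≤ (k:ℝ) ^ 2 / 2 * (C * (1 + k) ^ D * (R:ℝ) ^ D) := by gcongr
            _ = (k:ℝ) ^ 2 / 2 * (C * (1 + k) ^ D) * 4 ^ (D + 1) / c / (R:ℝ) ^ 2 *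
                (c * (R:ℝ) ^ D * (R:ℝ) ^ 2 / 4 ^ (D + 1)) := by field_simp
            _ ≤ _ := by gcongr
      _ = ∑ g ∈ W, w g * (∑ x ∈ b (R + k), f x ^ 2 - (k:ℝ) ^ 2 / 2 * (b (R + k)).card) := by
          rw [← Finset.sum_mul, hw1, one_mul]
      _ ≤ _ := Finset.sum_le_sum fun g hg => mul_le_mul_of_nonneg_left (hstep g hg) (hw0 g)

open Classical in
/-- The support of the lazy walk. -/
def Wsupp (r : ℕ) : Finset (FreeGroup (Fin r)) :=
  insert 1 (Finset.univ.image (fun i : Fin r => FreeGroup.of i) ∪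
    Finset.univ.image (fun i : Fin r => (FreeGroup.of i)⁻¹))

theorem lazySRW_nonneg (r : ℕ) (g : FreeGroup (Fin r)) : 0 ≤ lazySRW r g := by
  unfold lazySRW
  split_ifs <;> positivity

theorem lazySRW_inv (r : ℕ) (g : FreeGroup (Fin r)) : lazySRW r g⁻¹ = lazySRW r g := by
  unfold lazySRW
  have h : (∃ i : Fin r, g⁻¹ = FreeGroup.of i ∨ g⁻¹ = (FreeGroup.of i)⁻¹) ↔
      (∃ i : Fin r, g = FreeGroup.of i ∨ g = (FreeGroup.of i)⁻¹) := by
    refine exists_congr fun i => ?_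
    rw [inv_inj, inv_eq_iff_eq_inv, or_comm]
  simp only [inv_eq_one, h]

theorem Wsupp_mem (r : ℕ) (g : FreeGroup (Fin r)) : g ∈ Wsupp r ↔
    g = 1 ∨ ∃ i : Fin r, g = FreeGroup.of i ∨ g = (FreeGroup.of i)⁻¹ := by
  simp only [Wsupp, Finset.mem_insert, Finset.mem_union, Finset.mem_image, Finset.mem_univ,
    true_and, exists_or, eq_comm]

theorem Wsupp_inv (r : ℕ) (g : FreeGroup (Fin r)) (h : g ∈ Wsupp r) : g⁻¹ ∈ Wsupp r := by
  rw [Wsupp_mem] at h ⊢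
  rcases h with h | ⟨i, h | h⟩
  · left; simp [h]
  · right; exact ⟨i, Or.inr (by rw [h])⟩
  · right; exact ⟨i, Or.inl (by simp [h])⟩

theorem lazySRW_zero (r : ℕ) (g : FreeGroup (Fin r)) (h : g ∉ Wsupp r) : lazySRW r g = 0 := by
  rw [Wsupp_mem, not_or] at h
  simp only [lazySRW, if_neg h.1, if_neg h.2]

theorem of_ne_inv {r : ℕ} (i j : Fin r) : FreeGroup.of i ≠ (FreeGroup.of j)⁻¹ := by
  intro h
  have h1 := congrArg (FreeGroup.lift (fun _ : Fin r => Multiplicative.ofAdd (1:ℤ))) h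
  simp only [map_inv, FreeGroup.lift_apply_of] at h1
  have h2 := congrArg Multiplicative.toAdd h1
  simp at h2

theorem lazySRW_sum (r : ℕ) (hr : 2 ≤ r) : ∑ g ∈ Wsupp r, lazySRW r g = 1 := by
  classical
  have hr0 : (r:ℝ) ≠ 0 := by positivity
  have h1 : lazySRW r 1 = 1 / 2 := by simp [lazySRW]
  have h2 : ∀ i : Fin r, lazySRW r (FreeGroup.of i) = 1 / (4 * r) := by
    intro i
    simp only [lazySRW, if_neg (FreeGroup.of_ne_one i)]
    rw [if_pos ⟨i, Or.inl rfl⟩]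
  unfold Wsupp
  rw [Finset.sum_insert, Finset.sum_union, Finset.sum_image, Finset.sum_image]
  · simp only [lazySRW_inv, h1, h2]
    simp
    field_simp
    norm_num
  · intro i _ j _ h
    exact FreeGroup.of_injective (inv_injective h)
  · intro i _ j _ h
    exact FreeGroup.of_injective h
  · rw [Finset.disjoint_left]
    intro x hx hy
    obtain ⟨i, _, rfl⟩ := Finset.mem_image.1 hx
    obtain ⟨j, _, h⟩ := Finset.mem_image.1 hy
    exact of_ne_inv i j h.symm
  · simp only [Finset.mem_union, Finset.mem_image, Finset.mem_univ, true_and, not_or, not_exists]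
    exact ⟨fun i => FreeGroup.of_ne_one i, fun i h => FreeGroup.of_ne_one i (by simpa using h)⟩

theorem conv_lazy (r : ℕ) (M : Subgroup (FreeGroup (Fin r))) [M.Normal]
    (p : FreeGroup (Fin r) ⧸ M → ℝ) :
    conv (lazySRWQuot r M) p = Lop (Wsupp r) (lazySRW r) (QuotientGroup.mk' M) p := by
  classical
  ext x
  have hpush : ∀ h : FreeGroup (Fin r) ⧸ M, lazySRWQuot r M h =
      ∑ g ∈ Wsupp r with (QuotientGroup.mk' M g) = h, lazySRW r g := by
    intro h
    unfold lazySRWQuot pushforward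
    have e : ∑' g : {g : FreeGroup (Fin r) // (QuotientGroup.mk g : FreeGroup (Fin r) ⧸ M) = h},
        lazySRW r g.1 = ∑' g : FreeGroup (Fin r),
          Set.indicator {g | (QuotientGroup.mk g : FreeGroup (Fin r) ⧸ M) = h} (lazySRW r) g :=
      tsum_subtype {g | (QuotientGroup.mk g : FreeGroup (Fin r) ⧸ M) = h} (lazySRW r)
    rw [e, tsum_eq_sum (s := Wsupp r)]
    · rw [Finset.sum_filter]
      refine Finset.sum_congr rfl fun g _ => ?_
      rw [Set.indicator_apply]
      rfl
    · intro g hg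
      rw [Set.indicator_apply, lazySRW_zero r g hg, ite_self]
  unfold conv
  rw [tsum_eq_sum (s := (Wsupp r).image (QuotientGroup.mk' M))]
  · simp only [hpush, Finset.sum_mul]
    have e : ∀ h ∈ (Wsupp r).image (QuotientGroup.mk' M),
        ∑ g ∈ Wsupp r with (QuotientGroup.mk' M g) = h, lazySRW r g * p (h⁻¹ * x) =
        ∑ g ∈ Wsupp r with (QuotientGroup.mk' M g) = h,
          lazySRW r g * p ((QuotientGroup.mk' M g)⁻¹ * x) := by
      intro h _
      refine Finset.sum_congr rfl fun g hg => ?_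
      rw [(Finset.mem_filter.1 hg).2]
    rw [Finset.sum_congr rfl e, Finset.sum_fiberwise_of_maps_to
      (fun g hg => Finset.mem_image_of_mem _ hg)]
    unfold Lop
    refine Finset.sum_nbij' (·⁻¹) (·⁻¹) (Wsupp_inv r) (Wsupp_inv r) (by simp) (by simp) ?_
    intro g _
    rw [lazySRW_inv, map_inv]
  · intro h hh
    rw [hpush, Finset.filter_eq_empty_iff.2, Finset.sum_empty, zero_mul]
    intro g hg e
    exact hh (Finset.mem_image.2 ⟨g, hg, e⟩)

theorem convPow_lazy (r : ℕ) (M : Subgroup (FreeGroup (Fin r))) [M.Normal] (n : ℕ) :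
    convPow (lazySRWQuot r M) n = (Lop (Wsupp r) (lazySRW r) (QuotientGroup.mk' M))^[n]
      ⇑(Finsupp.single (1 : FreeGroup (Fin r) ⧸ M) (1:ℝ)) := by
  classical
  induction n with
  | zero =>
    ext g
    simp only [convPow, Function.iterate_zero, id, Finsupp.single_apply]
    by_cases hg : g = 1
    · simp [hg]
    · simp [hg, Ne.symm hg]
  | succ n ih =>
    rw [Function.iterate_succ_apply', ← ih, ← conv_lazy]
    rfl

theorem good_comm (r : ℕ) (M : Subgroup (FreeGroup (Fin r))) [M.Normal] (M' : Subgroup (FreeGroup (Fin r)))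
    [M'.Normal] (hM : M' = ⁅M, M⁆) (q : ℕ) (hq : 1 ≤ q) (ρ V : ℝ)
    (h : Good (Wsupp r) (lazySRW r) (QuotientGroup.mk' M) ρ V) :
    Good (Wsupp r) (lazySRW r) (QuotientGroup.mk' M') ((1 - 1 / (q:ℝ)) * ρ)
      (V * (q:ℝ) ^ ((Wsupp r).card * V)) := by
  have hle : M' ≤ M := by rw [hM]; exact Subgroup.commutator_le_left M M
  refine good_lift (Wsupp r) (lazySRW r) (lazySRW_nonneg r) (QuotientGroup.mk' M)
    (QuotientGroup.mk' M') (QuotientGroup.map M' M (MonoidHom.id _) hle) ?_ ?_ ?_ q hq ρ V h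
  · intro x
    obtain ⟨g, rfl⟩ := QuotientGroup.mk'_surjective M x
    exact ⟨QuotientGroup.mk' M' g, rfl⟩
  · intro g; rfl
  · intro a b ha hb
    obtain ⟨a, rfl⟩ := QuotientGroup.mk'_surjective M' a
    obtain ⟨b, rfl⟩ := QuotientGroup.mk'_surjective M' b
    have ha' : a ∈ M := (QuotientGroup.eq_one_iff (N := M) a).1 ha
    have hb' : b ∈ M := (QuotientGroup.eq_one_iff (N := M) b).1 hb
    rw [← commutatorElement_eq_one_iff_mul_comm, ← map_commutatorElement]
    refine (QuotientGroup.eq_one_iff (N := M') _).2 ?_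
    rw [hM]
    exact Subgroup.commutator_mem_commutator ha' hb'

theorem iterLog_nonneg (i : ℕ) (x : ℝ) (hx : 0 ≤ x) : 0 ≤ iterLog i x := by
  induction i with
  | zero => exact hx
  | succ i ih => exact Real.log_nonneg (by linarith)

theorem iterLog_anti (i : ℕ) (x : ℝ) (hx : 0 ≤ x) : iterLog (i + 1) x ≤ iterLog i x := by
  have h := iterLog_nonneg i x hx
  have := Real.log_le_sub_one_of_pos (by linarith : 0 < 1 + iterLog i x)
  simp only [iterLog]
  linarith

theorem exp_iterLog (i : ℕ) (x : ℝ) (hx : 0 ≤ x) :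
    Real.exp (iterLog (i + 1) x) = 1 + iterLog i x := by
  have h := iterLog_nonneg i x hx
  simp only [iterLog]
  exact Real.exp_log (by linarith)

theorem iterLog_le (i d : ℕ) (x : ℝ) (hx : 0 ≤ x) : iterLog (i + d) x ≤ iterLog i x := by
  induction d with
  | zero => exact le_rfl
  | succ d ih => exact (iterLog_anti (i + d) x hx).trans ih

theorem iterLog_tendsto (i : ℕ) : Filter.Tendsto (iterLog i) Filter.atTop Filter.atTop := by
  induction i with
  | zero => exact Filter.tendsto_id
  | succ i ih =>
    exact Real.tendsto_log_atTop.comp (Filter.tendsto_atTop_add_const_left _ 1 ih)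

theorem num_A (c : ℝ) (hc : 0 < c) : ∃ x0 : ℝ, 1 ≤ x0 ∧ ∀ y, x0 ≤ y →
    c * Real.exp (y / 2) * y ≤ (Real.exp y - 1) / (2 * y ^ 2) := by
  refine ⟨max 1 (1536 * c), le_max_left _ _, fun y hy => ?_⟩
  have hy1 : 1 ≤ y := (le_max_left _ _).trans hy
  have hy2 : 1536 * c ≤ y := (le_max_right _ _).trans hy
  have h1 := Real.pow_div_factorial_le_exp (y / 2) (by linarith) 4
  have h2 : Real.exp y = Real.exp (y / 2) * Real.exp (y / 2) := by rw [← Real.exp_add]; ring_nf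
  have h3 := Real.add_one_le_exp y
  rw [le_div_iff₀ (by positivity)]
  have h4 : 4 * c * y ^ 3 ≤ Real.exp (y / 2) := by
    refine le_trans ?_ h1
    have : (Nat.factorial 4 : ℝ) = 24 := by norm_num [Nat.factorial]
    rw [this]
    have h5 : 0 ≤ y ^ 3 := by positivity
    nlinarith [mul_le_mul_of_nonneg_left hy2 h5]
  have h6 : Real.exp (y / 2) * (4 * c * y ^ 3) ≤ Real.exp y := by
    rw [h2]; gcongr
  nlinarith

theorem num_B (A : ℝ) (hA : 0 ≤ A) (X : ℝ) (hX0 : 0 ≤ X) (hX : 2 * A ^ 2 ≤ X) :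
    A * Real.log (1 + X) ≤ X := by
  have hy0 : 0 ≤ Real.log (1 + X) := Real.log_nonneg (by linarith)
  have he : Real.exp (Real.log (1 + X)) = 1 + X := Real.exp_log (by linarith)
  set y := Real.log (1 + X)
  have hq := Real.quadratic_le_exp_of_nonneg hy0
  by_cases h : y ≤ 2 * A
  · nlinarith
  · push Not at h
    nlinarith

/-- Volume bounds along the tower. -/
def Vseq (c C1 : ℝ) (D R : ℕ) : ℕ → ℝ
  | 0 => C1 * (R:ℝ) ^ D
  | j + 1 => Real.exp (c * Vseq c C1 D R j * Real.log R)

theorem Vseq_pos (c C1 : ℝ) (hC : 0 < C1) (D R : ℕ) (hR : 1 ≤ R) (j : ℕ) :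
    0 < Vseq c C1 D R j := by
  have : (0:ℝ) < R := by exact_mod_cast hR
  cases j with
  | zero => simp only [Vseq]; positivity
  | succ j => exact Real.exp_pos _

theorem good_tower (r : ℕ) (hr : 2 ≤ r) (N : Subgroup (FreeGroup (Fin r))) [N.Normal]
    (D : ℕ) (hgrowth : HasPolyGrowth (FreeGroup (Fin r) ⧸ N) D) :
    ∃ c c1 C1 : ℝ, 0 < c ∧ 0 ≤ c1 ∧ 0 < C1 ∧ ∀ R : ℕ, 2 ≤ R → ∀ j : ℕ,
      Good (Wsupp r) (lazySRW r) (QuotientGroup.mk' (iterComm N j))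
        (1 - (c1 + j) / (R:ℝ) ^ 2) (Vseq c C1 D R j) := by
  obtain ⟨c1, C1, hc1, hC1, hbase⟩ := good_base (Wsupp r) (lazySRW r) (QuotientGroup.mk' N)
    (lazySRW_nonneg r) (lazySRW_sum r hr) D hgrowth
  refine ⟨2 * (Wsupp r).card + 2, c1, C1, by positivity, hc1, hC1, ?_⟩
  intro R hR j
  have hR1 : (2:ℝ) ≤ R := by exact_mod_cast hR
  have hR2 : (0:ℝ) < (R:ℝ) ^ 2 := by positivity
  induction j with
  | zero =>
    simp only [Vseq, Nat.cast_zero, add_zero]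
    exact hbase R hR
  | succ j ih =>
    have h := good_comm r (iterComm N j) (iterComm N (j + 1)) rfl (R ^ 2)
      (Nat.one_le_pow _ _ (by omega)) _ _ ih
    set V := Vseq (2 * (Wsupp r).card + 2) C1 D R j with hV
    have hVpos : 0 < V := Vseq_pos _ _ hC1 _ _ (by omega) j
    obtain ⟨U, f, h1, h2, h3, h4, h5⟩ := h
    refine ⟨U, f, h1, h2, h3, h4.trans ?_, le_trans (mul_le_mul_of_nonneg_right ?_ h3.le) h5⟩
    · simp only [Vseq]
      rw [← hV]
      have hlog : (1:ℝ) / 2 ≤ Real.log R := by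
        have := Real.log_two_gt_d9
        have := Real.log_le_log (by norm_num) hR1
        linarith
      have e1 : V ≤ Real.exp (2 * V * Real.log R) := by
        have := Real.add_one_le_exp (2 * V * Real.log R)
        nlinarith
      have e2 : ((R ^ 2 : ℕ) : ℝ) ^ ((Wsupp r).card * V) =
          Real.exp (2 * (Wsupp r).card * V * Real.log R) := by
        rw [Real.rpow_def_of_pos (by push_cast; positivity)]
        push_cast
        rw [Real.log_pow]
        push_cast
        congr 1; ring
      rw [e2]
      calc _ ≤ Real.exp (2 * V * Real.log R) * Real.exp (2 * (Wsupp r).card * V * Real.log R) := by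
            gcongr
        _ = _ := by rw [← Real.exp_add]; congr 1; ring
    · push_cast
      have : 0 ≤ (c1 + j) / (R:ℝ) ^ 2 * (1 / (R:ℝ) ^ 2) := by positivity
      have e : (c1 + (j + 1)) / (R:ℝ) ^ 2 = (c1 + j) / (R:ℝ) ^ 2 + 1 / (R:ℝ) ^ 2 := by ring
      rw [e]
      nlinarith

set_option maxHeartbeats 1000000 in
theorem num_final (c C1 : ℝ) (hc : 0 < c) (hC1 : 0 < C1) (D : ℕ) (hD : 1 ≤ D) (R0 : ℕ)
    (hR0 : 2 ≤ R0) (m : ℕ) :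
    ∃ K : ℝ, ∃ n₀ : ℕ, ∀ n : ℕ, n₀ ≤ n → ∃ R : ℕ, R0 ≤ R ∧
      1 / (R:ℝ) ^ 2 ≤ K * (iterLog (m + 2) n / iterLog (m + 1) n) ^ ((2:ℝ) / (D:ℝ)) ∧
      Vseq c C1 D R (m + 2) ≤ Real.exp (n / (R:ℝ) ^ 2) := by
  obtain ⟨x0, hx01, hA⟩ := num_A c hc
  set δ : ℝ := min 1 (1 / (2 * c * C1)) with hδ
  have hδ0 : 0 < δ := lt_min one_pos (by positivity)
  have hδ1 : δ ≤ 1 := min_le_left _ _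
  have hδ2 : c * C1 * δ ≤ 1 / 2 := by
    have : δ ≤ 1 / (2 * c * C1) := min_le_right _ _
    rw [le_div_iff₀ (by positivity)] at this
    linarith
  set A : ℝ := (R0:ℝ) ^ D / δ with hAdef
  have hA0 : 0 ≤ A := by positivity
  have hev : ∀ᶠ n : ℕ in Filter.atTop, max x0 (max 2 (2 * A ^ 2)) ≤ iterLog (m + 1) (n:ℝ) :=
    ((iterLog_tendsto (m + 1)).comp tendsto_natCast_atTop_atTop).eventually_ge_atTop _
  obtain ⟨n₀, hn₀⟩ := Filter.eventually_atTop.1 hev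
  refine ⟨4 * (δ⁻¹) ^ ((2:ℝ) / (D:ℝ)), n₀, fun n hn => ?_⟩
  have hn0 : (0:ℝ) ≤ n := Nat.cast_nonneg n
  have hbig := hn₀ n hn
  set X := iterLog (m + 1) (n:ℝ) with hX
  have hXx0 : x0 ≤ X := (le_max_left _ _).trans hbig
  have hX2 : 2 ≤ X := (le_max_left _ _).trans ((le_max_right _ _).trans hbig)
  have hXA : 2 * A ^ 2 ≤ X := (le_max_right _ _).trans ((le_max_right _ _).trans hbig)
  have hlog : iterLog (m + 2) (n:ℝ) = Real.log (1 + X) := rfl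
  rw [hlog]
  have hY1 : 1 ≤ Real.log (1 + X) := by
    rw [Real.le_log_iff_exp_le (by linarith)]
    have := Real.exp_one_lt_d9
    linarith
  have hB := num_B A hA0 X (by linarith) hXA
  set Y := Real.log (1 + X) with hY
  set Z : ℝ := δ * X / Y with hZ
  have hY0 : 0 < Y := by linarith
  have hX0 : 0 < X := by linarith
  have hZ0 : 0 < Z := by positivity
  have hZR : (R0:ℝ) ^ D ≤ Z := by
    rw [hZ, le_div_iff₀ hY0]
    rw [hAdef, div_mul_eq_mul_div, div_le_iff₀ hδ0] at hB
    linarith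
  have hZX : Z ≤ X := by
    rw [hZ, div_le_iff₀ hY0]
    nlinarith
  have hD0 : (D:ℝ) ≠ 0 := by positivity
  set T : ℝ := Z ^ ((1:ℝ) / D) with hT
  have hT0 : 0 < T := Real.rpow_pos_of_pos hZ0 _
  have hTD : T ^ D = Z := by
    rw [hT, ← Real.rpow_natCast, ← Real.rpow_mul hZ0.le]
    field_simp
    simp
  have hTR0 : (R0:ℝ) ≤ T := by
    by_contra h
    push Not at h
    have := pow_lt_pow_left₀ h hT0.le (by omega : D ≠ 0)
    rw [hTD] at this
    linarith
  have hR : R0 ≤ ⌊T⌋₊ := Nat.le_floor hTR0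
  have hRT : ((⌊T⌋₊ : ℕ) : ℝ) ≤ T := Nat.floor_le hT0.le
  have hTR : T < (⌊T⌋₊ : ℕ) + 1 := Nat.lt_floor_add_one T
  refine ⟨⌊T⌋₊, hR, ?_⟩
  set R := ⌊T⌋₊
  have hR2 : (2:ℝ) ≤ R := by exact_mod_cast hR0.trans hR
  have hRD : (R:ℝ) ^ D ≤ Z := by rw [← hTD]; gcongr
  have hRX : (R:ℝ) ≤ X := by
    have : (R:ℝ) ^ 1 ≤ (R:ℝ) ^ D := pow_le_pow_right₀ (by linarith) hD
    rw [pow_one] at this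
    linarith
  have hlogR : Real.log R ≤ Y := Real.log_le_log (by linarith) (by linarith)
  have hlogR0 : 0 ≤ Real.log R := Real.log_nonneg (by linarith)
  have hlogX : Real.log R ≤ X := by
    have := Real.log_le_sub_one_of_pos (by linarith : (0:ℝ) < R)
    linarith
  constructor
  · have h1 : T ^ 2 ≤ 4 * (R:ℝ) ^ 2 := by nlinarith
    have h2 : T ^ 2 = Z ^ ((2:ℝ) / D) := by
      rw [hT, ← Real.rpow_natCast, ← Real.rpow_mul hZ0.le]
      congr 1; push_cast; ring
    have h3 : δ⁻¹ ^ ((2:ℝ) / D) * (Y / X) ^ ((2:ℝ) / D) = (T ^ 2)⁻¹ := by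
      rw [h2, ← Real.inv_rpow hZ0.le, ← Real.mul_rpow (by positivity) (by positivity)]
      congr 1
      rw [hZ]; field_simp
    rw [mul_assoc, h3]
    have hT2 : 0 < T ^ 2 := by positivity
    rw [← div_eq_mul_inv, div_le_div_iff₀ (by positivity) hT2]
    linarith
  · have claim : ∀ j, j ≤ m →
        Vseq c C1 D R (j + 1) ≤ Real.exp (iterLog (m + 1 - j) (n:ℝ) / 2) := by
      intro j
      induction j with
      | zero =>
        intro _
        simp only [Vseq, Nat.sub_zero]
        rw [← hX]
        apply Real.exp_le_exp.2
        calc c * (C1 * (R:ℝ) ^ D) * Real.log R ≤ c * (C1 * Z) * Y := by gcongr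
          _ = (c * C1 * δ) * X := by rw [hZ]; field_simp
          _ ≤ 1 / 2 * X := by gcongr
          _ = X / 2 := by ring
      | succ j ih =>
        intro hj
        have ih := ih (by omega)
        have e1 : m + 1 - j = (m + 1 - (j + 1)) + 1 := by omega
        have hy : X ≤ iterLog (m + 1 - j) (n:ℝ) := by
          have := iterLog_le (m + 1 - j) j n hn0
          rwa [show m + 1 - j + j = m + 1 by omega] at this
        have hex := exp_iterLog (m + 1 - (j + 1)) n hn0
        rw [← e1] at hex
        set y := iterLog (m + 1 - j) (n:ℝ)
        have hAy := hA y (hXx0.trans hy)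
        have hV := Vseq_pos c C1 hC1 D R (by omega) (j + 1)
        rw [Vseq]
        apply Real.exp_le_exp.2
        calc c * Vseq c C1 D R (j + 1) * Real.log R ≤ c * Real.exp (y / 2) * y := by
              gcongr; linarith
          _ ≤ (Real.exp y - 1) / (2 * y ^ 2) := hAy
          _ ≤ (Real.exp y - 1) / 2 := by
              have : 0 ≤ Real.exp y - 1 := by
                have := Real.add_one_le_exp y
                linarith
              gcongr
              nlinarith
          _ = _ := by rw [hex]; ring
    have hl := claim m le_rfl
    rw [show m + 1 - m = 1 by omega] at hl
    have hy : X ≤ iterLog 1 (n:ℝ) := by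
      have := iterLog_le 1 m n hn0
      rwa [show 1 + m = m + 1 by omega] at this
    have hex := exp_iterLog 0 n hn0
    rw [zero_add] at hex
    set y := iterLog 1 (n:ℝ)
    have hAy := hA y (hXx0.trans hy)
    have hV := Vseq_pos c C1 hC1 D R (by omega) (m + 1)
    rw [Vseq]
    apply Real.exp_le_exp.2
    calc c * Vseq c C1 D R (m + 1) * Real.log R ≤ c * Real.exp (y / 2) * y := by
          gcongr; linarith
      _ ≤ (Real.exp y - 1) / (2 * y ^ 2) := hAy
      _ = n / (2 * y ^ 2) := by rw [hex]; simp [iterLog]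
      _ ≤ n / (R:ℝ) ^ 2 := by
          have hRy : (R:ℝ) ^ 2 ≤ y ^ 2 := pow_le_pow_left₀ (by linarith) (hRX.trans hy) 2
          have hR2p : (0:ℝ) < (R:ℝ) ^ 2 := by positivity
          exact div_le_div_of_nonneg_left hn0 hR2p (by linarith)

/-- Corollary: if `Γ₁(N) = F_r/N` has polynomial volume growth of degree `D ≥ 1` then, for
`ℓ ≥ 3`, the lazy simple random walk on `Γ_ℓ(N) = F_r/N^{(ℓ)}` satisfies
`μ_ℓ^{(2n)}(e) ≥ exp(− C n (log_{[ℓ-1]} n / log_{[ℓ-2]} n)^{2/D})` for large `n`. -/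
theorem return_probability_lower_iterated_polynomial (r : ℕ) (hr : 2 ≤ r)
    (N : Subgroup (FreeGroup (Fin r))) [N.Normal]
    (D : ℕ) (hD : 1 ≤ D)
    (hgrowth : HasPolyGrowth (FreeGroup (Fin r) ⧸ N) D)
    (ℓ : ℕ) (hℓ : 3 ≤ ℓ) :
    ∃ C : ℝ, ∃ n₀ : ℕ, ∀ n : ℕ, n₀ ≤ n →
      Real.exp (-C * (n : ℝ) *
          (iterLog (ℓ - 1) n / iterLog (ℓ - 2) n) ^ ((2 : ℝ) / (D : ℝ)))
        ≤ convPow (lazySRWQuot r (iterComm N (ℓ - 1))) (2 * n) 1 := by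
  obtain ⟨c, c1, C1, hc, hc1, hC1, htower⟩ := good_tower r hr N D hgrowth
  obtain ⟨m, rfl⟩ : ∃ m, ℓ = m + 3 := ⟨ℓ - 3, by omega⟩
  rw [show m + 3 - 1 = m + 2 by omega, show m + 3 - 2 = m + 1 by omega]
  set a : ℝ := c1 + (m + 2 : ℕ) with ha
  have ha0 : 0 ≤ a := by positivity
  obtain ⟨R0, hR0⟩ := exists_nat_ge (2 * a + 2)
  have hR02 : 2 ≤ R0 := by
    have : (2:ℝ) ≤ R0 := by linarith
    exact_mod_cast this
  obtain ⟨K, n₀, hK⟩ := num_final c C1 hc hC1 D hD R0 hR02 m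
  refine ⟨(4 * a + 1) * K, n₀, fun n hn => ?_⟩
  obtain ⟨R, hR, h1, h2⟩ := hK n hn
  have hRR : 2 * a + 2 ≤ (R:ℝ) := hR0.trans (by exact_mod_cast hR)
  have hRpos : (0:ℝ) < (R:ℝ) ^ 2 := by
    have : (0:ℝ) < R := by linarith
    positivity
  set x : ℝ := a / (R:ℝ) ^ 2 with hx
  have hx0 : 0 ≤ x := by positivity
  have hx1 : x ≤ 1 / 2 := by
    rw [hx, div_le_iff₀ hRpos]
    nlinarith
  have hgood := htower R (by omega) (m + 2)
  rw [← ha, ← hx] at hgood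
  have hret := return_of_good (Wsupp r) (lazySRW r) (QuotientGroup.mk' (iterComm N (m + 2)))
    (Wsupp_inv r) (lazySRW_inv r) _ _ (by linarith) hgood n
  rw [← convPow_lazy] at hret
  set p := convPow (lazySRWQuot r (iterComm N (m + 2))) (2 * n) 1
  have hVpos := Vseq_pos c C1 hC1 D R (by omega) (m + 2)
  have hρ : Real.exp (-(2 * x)) ≤ 1 - x := by
    rw [Real.exp_neg, inv_le_iff_one_le_mul₀ (Real.exp_pos _)]
    have := Real.add_one_le_exp (2 * x)
    nlinarith
  have hpow : Real.exp (-(4 * n * x)) ≤ (1 - x) ^ (2 * n) := by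
    calc Real.exp (-(4 * n * x)) = Real.exp (-(2 * x)) ^ (2 * n) := by
          rw [← Real.exp_nat_mul]; congr 1; push_cast; ring
      _ ≤ _ := by gcongr
  have hp0 : 0 ≤ p := by
    by_contra hneg
    push Not at hneg
    have : Vseq c C1 D R (m + 2) * p < 0 := mul_neg_of_pos_of_neg hVpos hneg
    have := Real.exp_pos (-(4 * n * x))
    linarith
  have hfin : Real.exp (-(4 * n * x)) ≤ Real.exp (n / (R:ℝ) ^ 2) * p :=
    hpow.trans (hret.trans (mul_le_mul_of_nonneg_right h2 hp0))
  have hfin2 : Real.exp (-(4 * n * x) - n / (R:ℝ) ^ 2) ≤ p := by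
    rw [Real.exp_sub, div_le_iff₀ (Real.exp_pos _)]
    linarith
  refine le_trans (Real.exp_le_exp.2 ?_) hfin2
  have e : -(4 * n * x) - n / (R:ℝ) ^ 2 = -((4 * a + 1) * n * (1 / (R:ℝ) ^ 2)) := by
    rw [hx]; ring
  rw [e]
  have hcoef : 0 ≤ (4 * a + 1) * (n:ℝ) := by positivity
  have := mul_le_mul_of_nonneg_left h1 hcoef
  linarith

end
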